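/- Let α, β be real numbers such that 1, α, β are linearly independent over Q, and let ε > 0. Then there exist arbitrarily large X for which the system |x₀ + x₁α + x₂β| ≤ ε X^{-γ}, 0 < x₁ ≤ X, 0 < x₂ ≤ X has a solution (x₀,x₁,x₂) ∈ Z^3, where γ = (1+√5)/2. -/

import Mathlib

noncomputable section

/-- Cross product in ℝ³. -/
def cross3 (x y : Fin 3 → ℝ) : Fin 3 → ℝ :=
  ![x 1 * y 2 - x 2 * y 1, x 2 * y 0 - x 0 * y 2, x 0 * y 1 - x 1 * y 0]

/-- Scalar product in ℝ³. -/
def dot3 (x y : Fin 3 → ℝ) : ℝ := x 0 * y 0 + x 1 * y 1 + x 2 * y 2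

/-- Euclidean norm in ℝ³. -/
def nrm (x : Fin 3 → ℝ) : ℝ := Real.sqrt (dot3 x x)

/-- Projective distance between nonzero vectors of ℝ³. -/
def pdist (x y : Fin 3 → ℝ) : ℝ := nrm (cross3 x y) / (nrm x * nrm y)

/-- The canonical map ℤ³ → ℝ³. -/
def toR (x : Fin 3 → ℤ) : Fin 3 → ℝ := fun i => (x i : ℝ)

/-- Determinant of three vectors of ℝ³. -/
def det3 (a b c : Fin 3 → ℝ) : ℝ :=
  a 0 * (b 1 * c 2 - b 2 * c 1) - a 1 * (b 0 * c 2 - b 2 * c 0) + a 2 * (b 0 * c 1 - b 1 * c 0)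

/-- Determinant of three vectors of ℤ³. -/
def det3Z (a b c : Fin 3 → ℤ) : ℤ :=
  a 0 * (b 1 * c 2 - b 2 * c 1) - a 1 * (b 0 * c 2 - b 2 * c 0) + a 2 * (b 0 * c 1 - b 1 * c 0)

/-- Cross product of integer vectors. -/
def crossZ (x y : Fin 3 → ℤ) : Fin 3 → ℤ :=
  ![x 1 * y 2 - x 2 * y 1, x 2 * y 0 - x 0 * y 2, x 0 * y 1 - x 1 * y 0]

/-- A point of ℤ³ is primitive if its coordinates are coprime (in particular it is nonzero). -/
def IsPrimitive (x : Fin 3 → ℤ) : Prop := Int.gcd (Int.gcd (x 0) (x 1)) (x 2) = 1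

/-- A pair of points of ℤ³ is primitive if their cross product is a primitive point. -/
def PrimPair (x y : Fin 3 → ℤ) : Prop := IsPrimitive (crossZ x y)

/-- The golden ratio. -/
def γ : ℝ := (1 + Real.sqrt 5) / 2


/-- The linear form. -/
def Lf (α β : ℝ) (x : Fin 3 → ℤ) : ℝ := (x 0 : ℝ) + (x 1 : ℝ) * α + (x 2 : ℝ) * β

/-- Hexagonal norm of the last two coordinates. -/
def hN (x : Fin 3 → ℤ) : ℤ := max (max |x 1| |x 2|) |x 1 - x 2|

lemma hN_nonneg (x : Fin 3 → ℤ) : 0 ≤ hN x :=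
  le_trans (abs_nonneg (x 1 - x 2)) (le_max_right _ _)

lemma hN_neg (x : Fin 3 → ℤ) : hN (-x) = hN x := by
  have h : -x 1 - -x 2 = -(x 1 - x 2) := by ring
  simp only [hN, Pi.neg_apply, abs_neg, h]

lemma Lf_neg (α β : ℝ) (x : Fin 3 → ℤ) : Lf α β (-x) = - Lf α β x := by
  simp only [Lf, Pi.neg_apply]; push_cast; ring

lemma hN_le_iff (x : Fin 3 → ℤ) (H : ℤ) : hN x ≤ H ↔ |x 1| ≤ H ∧ |x 2| ≤ H ∧ |x 1 - x 2| ≤ H := by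
  simp only [hN, max_le_iff, and_assoc]

lemma hN_lt_iff (x : Fin 3 → ℤ) (H : ℤ) : hN x < H ↔ |x 1| < H ∧ |x 2| < H ∧ |x 1 - x 2| < H := by
  simp only [hN, max_lt_iff, and_assoc]

lemma finite_box (α β c : ℝ) (H : ℤ) : {x : Fin 3 → ℤ | hN x ≤ H ∧ |Lf α β x| ≤ c}.Finite := by
  set R : ℝ := c + H * |α| + H * |β| with hR
  set N : ℤ := ⌈R⌉ with hN'
  refine (Set.finite_Icc (![-N, -H, -H] : Fin 3 → ℤ) (![N, H, H])).subset ?_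
  rintro x ⟨h1, h2⟩
  obtain ⟨a, b, -⟩ := (hN_le_iff x H).1 h1
  have a' : |(x 1 : ℝ)| ≤ H := by exact_mod_cast a
  have b' : |(x 2 : ℝ)| ≤ H := by exact_mod_cast b
  have e1 : |(x 1 : ℝ) * α| ≤ H * |α| := by rw [abs_mul]; gcongr
  have e2 : |(x 2 : ℝ) * β| ≤ H * |β| := by rw [abs_mul]; gcongr
  have e0 : |(x 0 : ℝ)| ≤ R := by
    have := abs_le.1 h2
    have := abs_le.1 e1
    have := abs_le.1 e2
    unfold Lf at *
    rw [abs_le]; constructor <;> linarith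
  have e0' : |(x 0 : ℝ)| ≤ N := e0.trans (Int.le_ceil R)
  have e0'' : |x 0| ≤ N := by exact_mod_cast e0'
  rw [abs_le] at a b e0''
  constructor <;> intro i <;> fin_cases i <;> simp <;> omega

lemma dirichlet (α β : ℝ) (Q : ℕ) (hQ : 1 ≤ Q) :
    ∃ q : Fin 3 → ℤ, q ≠ 0 ∧ hN q ≤ 2 * Q ∧ |Lf α β q| < 1 / (Q : ℝ) ^ 2 := by
  have hQ0 : (0 : ℝ) < (Q : ℝ) ^ 2 := by positivity
  let f : ℕ × ℕ → ℕ := fun p => ⌊Int.fract ((p.1 : ℝ) * α + p.2 * β) * (Q : ℝ) ^ 2⌋₊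
  have hf : ∀ p, f p ∈ Finset.range (Q ^ 2) := by
    intro p
    rw [Finset.mem_range]
    show ⌊_⌋₊ < _
    rw [Nat.floor_lt (by positivity)]
    push_cast
    have := Int.fract_lt_one ((p.1 : ℝ) * α + p.2 * β)
    nlinarith
  obtain ⟨p, hp, p', hp', hne, heq⟩ := Finset.exists_ne_map_eq_of_card_lt_of_maps_to
    (s := Finset.range (Q + 1) ×ˢ Finset.range (Q + 1)) (t := Finset.range (Q ^ 2)) (f := f)
    (by simp; nlinarith) (fun p _ => hf p)
  simp only [Finset.mem_product, Finset.mem_range] at hp hp'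
  set s := (p.1 : ℝ) * α + p.2 * β with hs
  set s' := (p'.1 : ℝ) * α + p'.2 * β with hs'
  refine ⟨![⌊s'⌋ - ⌊s⌋, (p.1 : ℤ) - p'.1, (p.2 : ℤ) - p'.2], ?_, ?_, ?_⟩
  · intro h
    apply hne
    have h1 := congrFun h 1
    have h2 := congrFun h 2
    simp at h1 h2
    ext <;> omega
  · rw [hN_le_iff]
    simp only [abs_le]
    simp
    omega
  · have e : Lf α β ![⌊s'⌋ - ⌊s⌋, (p.1 : ℤ) - p'.1, (p.2 : ℤ) - p'.2] = Int.fract s - Int.fract s' := by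
      have a1 := Int.self_sub_floor s
      have a2 := Int.self_sub_floor s'
      simp only [Lf, Matrix.cons_val]
      push_cast
      linear_combination a1 - a2 - hs + hs'
    rw [e, lt_div_iff₀ hQ0]
    have h1 : f p ≤ Int.fract s * (Q : ℝ) ^ 2 := Nat.floor_le (by positivity)
    have h2 : Int.fract s * (Q : ℝ) ^ 2 < f p + 1 := Nat.lt_floor_add_one _
    have h3 : f p' ≤ Int.fract s' * (Q : ℝ) ^ 2 := Nat.floor_le (by positivity)
    have h4 : Int.fract s' * (Q : ℝ) ^ 2 < f p' + 1 := Nat.lt_floor_add_one _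
    rw [heq] at h1 h2
    have : |Int.fract s - Int.fract s'| * (Q : ℝ) ^ 2 = |Int.fract s * (Q : ℝ) ^ 2 - Int.fract s' * (Q : ℝ) ^ 2| := by
      rw [← sub_mul, abs_mul, abs_of_pos hQ0]
    rw [this, abs_lt]
    constructor <;> linarith

/-- A minimal point. -/
def IsMin3 (α β : ℝ) (x : Fin 3 → ℤ) : Prop :=
  x ≠ 0 ∧ ∀ q : Fin 3 → ℤ, q ≠ 0 → hN q ≤ hN x → |Lf α β x| ≤ |Lf α β q|

lemma next_min (α β : ℝ) (hL : ∀ q : Fin 3 → ℤ, q ≠ 0 → Lf α β q ≠ 0) (x : Fin 3 → ℤ)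
    (hx : IsMin3 α β x) :
    ∃ y, IsMin3 α β y ∧ hN x < hN y ∧ |Lf α β y| < |Lf α β x| ∧
      ∀ q : Fin 3 → ℤ, q ≠ 0 → hN q < hN y → |Lf α β x| ≤ |Lf α β q| := by
  have hpos : 0 < |Lf α β x| := abs_pos.2 (hL x hx.1)
  have hex : ∃ n : ℕ, ∃ q : Fin 3 → ℤ, q ≠ 0 ∧ |Lf α β q| < |Lf α β x| ∧ hN q = n := by
    obtain ⟨Q, hQ⟩ := exists_nat_gt (1 / |Lf α β x|)
    have hQpos : 0 < (Q : ℝ) := lt_trans (by positivity) hQ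
    have hQ1 : 1 ≤ Q := by exact_mod_cast hQpos
    obtain ⟨q, h1, h2, h3⟩ := dirichlet α β Q hQ1
    refine ⟨(hN q).toNat, q, h1, h3.trans_le ?_, ?_⟩
    · rw [div_lt_iff₀ hpos] at hQ
      rw [div_le_iff₀ (by positivity)]
      have : (1 : ℝ) ≤ Q := by exact_mod_cast hQ1
      nlinarith
    · have := hN_nonneg q
      omega
  classical
  obtain ⟨q0, hq0, hq0L, hq0n⟩ := Nat.find_spec hex
  have hmin : ∀ q : Fin 3 → ℤ, q ≠ 0 → |Lf α β q| < |Lf α β x| → (Nat.find hex : ℤ) ≤ hN q := by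
    intro q hq hqL
    have h0 := hN_nonneg q
    have := Nat.find_min' hex (m := (hN q).toNat) ⟨q, hq, hqL, by omega⟩
    omega
  set n := Nat.find hex
  let T : Set (Fin 3 → ℤ) := {q | q ≠ 0 ∧ |Lf α β q| < |Lf α β x| ∧ hN q = n}
  have hT : T.Finite := (finite_box α β |Lf α β x| n).subset
    (fun q hq => ⟨hq.2.2.le, hq.2.1.le⟩)
  obtain ⟨y, hyT, hy⟩ := Set.exists_min_image T (fun q => |Lf α β q|) hT ⟨q0, hq0, hq0L, hq0n⟩
  obtain ⟨hy0, hyL, hyn⟩ := hyT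
  refine ⟨y, ⟨hy0, ?_⟩, ?_, hyL, ?_⟩
  · intro q hq hqn
    by_cases h : |Lf α β q| < |Lf α β x|
    · exact hy q ⟨hq, h, le_antisymm (hyn ▸ hqn) (hmin q hq h)⟩
    · exact hyL.le.trans (not_lt.1 h)
  · by_contra h
    exact absurd (hx.2 y hy0 (not_lt.1 h)) (not_le.2 hyL)
  · intro q hq hqn
    by_contra h
    have := hmin q hq (not_le.1 h)
    omega

lemma exists_seq (α β : ℝ) (hL : ∀ q : Fin 3 → ℤ, q ≠ 0 → Lf α β q ≠ 0) :
    ∃ x : ℕ → Fin 3 → ℤ, ∀ k, x k ≠ 0 ∧ hN (x k) < hN (x (k + 1)) ∧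
      |Lf α β (x (k + 1))| < |Lf α β (x k)| ∧
      ∀ q : Fin 3 → ℤ, q ≠ 0 → hN q < hN (x (k + 1)) → |Lf α β (x k)| ≤ |Lf α β q| := by
  have h0 : IsMin3 α β ![1, 0, 0] := by
    refine ⟨fun h => by simpa using congrFun h 0, ?_⟩
    intro q hq hqn
    have : hN ![1, 0, 0] = 0 := by simp [hN]
    rw [this, hN_le_iff] at hqn
    obtain ⟨a, b, -⟩ := hqn
    have a' : q 1 = 0 := by simpa using a
    have b' : q 2 = 0 := by simpa using b
    have c' : q 0 ≠ 0 := by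
      intro c; apply hq; ext i; fin_cases i <;> simp [*]
    simp [Lf, a', b']
    exact_mod_cast Int.one_le_abs c'
  choose f hf using fun x : {x // IsMin3 α β x} => next_min α β hL x.1 x.2
  let g : ℕ → {x // IsMin3 α β x} := fun n => Nat.rec ⟨_, h0⟩ (fun _ x => ⟨f x, (hf x).1⟩) n
  refine ⟨fun k => (g k).1, fun k => ⟨(g k).2.1, ?_⟩⟩
  exact (hf (g k)).2

lemma seq_bound (α β : ℝ) (x y : Fin 3 → ℤ) (hy : 3 ≤ hN y)
    (h : ∀ q : Fin 3 → ℤ, q ≠ 0 → hN q < hN y → |Lf α β x| ≤ |Lf α β q|) :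
    |Lf α β x| * (hN y : ℝ) ^ 2 ≤ 16 := by
  obtain ⟨Q, hQ⟩ : ∃ Q : ℕ, (Q : ℤ) = (hN y - 1) / 2 := ⟨((hN y - 1) / 2).toNat, by omega⟩
  have hQ1 : 1 ≤ Q := by omega
  obtain ⟨q, h1, h2, h3⟩ := dirichlet α β Q hQ1
  have h4 := (h q h1 (by omega)).trans h3.le
  have h5 : hN y ≤ 4 * (Q : ℤ) := by omega
  have h6 : (hN y : ℝ) ≤ 4 * (Q : ℝ) := by exact_mod_cast h5
  have h7 : (0 : ℝ) ≤ hN y := by exact_mod_cast hN_nonneg y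
  have hQ0 : (0 : ℝ) < (Q : ℝ) ^ 2 := by positivity
  rw [le_div_iff₀ hQ0] at h4
  have : (hN y : ℝ) ^ 2 ≤ 16 * (Q : ℝ) ^ 2 := by nlinarith
  calc _ ≤ |Lf α β x| * (16 * (Q : ℝ) ^ 2) := by gcongr
    _ ≤ 16 := by linarith

lemma gam_sq : γ ^ 2 = γ + 1 := by
  unfold γ
  have := Real.sq_sqrt (show (0 : ℝ) ≤ 5 by norm_num)
  nlinarith

lemma gam_gt : 1 < γ := by
  unfold γ
  have : (1 : ℝ) < Real.sqrt 5 := by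
    rw [Real.lt_sqrt] <;> norm_num
  linarith

lemma gam_lt : γ < 2 := by
  have := gam_sq
  have := gam_gt
  nlinarith

/-- The negation of the theorem, as a predicate. -/
def NegS (α β ε X₀ : ℝ) : Prop := ∀ X : ℝ, X₀ ≤ X → ∀ z : Fin 3 → ℤ,
  0 < z 1 → (z 1 : ℝ) ≤ X → 0 < z 2 → (z 2 : ℝ) ≤ X → ε * X ^ (-γ) < |Lf α β z|

lemma coord (u1 u2 p1 p2 : ℝ) (hu : 0 < u1 - u2) :
    p1 = (u1 * p2 - u2 * p1) / (u1 - u2) + (p1 - p2) / (u1 - u2) * u1 ∧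
    p2 = (u1 * p2 - u2 * p1) / (u1 - u2) + (p1 - p2) / (u1 - u2) * u2 := by
  have := hu.ne'
  constructor <;> field_simp <;> ring

/-- The elementary analytic step. -/
lemma analytic3 (ε lam X : ℝ) (hε : 0 < ε) (hlam : 0 < lam) (hX : 0 < X)
    (h : ε * (256 / (lam * X)) ^ (-γ) < 2 * lam) :
    lam * X ^ (γ + 1) ≤ (2 * 256 ^ γ / ε) ^ γ := by
  have g1 := gam_gt
  have g2 := gam_sq
  set μ := lam * X with hμ
  have hμ0 : 0 < μ := by positivity
  have h256 : (0 : ℝ) < 256 ^ γ := by positivity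
  rw [Real.rpow_neg (by positivity), Real.div_rpow (by norm_num) hμ0.le, inv_div] at h
  have h1 : μ ^ γ * X < μ * (2 * 256 ^ γ / ε) := by
    have : ε * (μ ^ γ / 256 ^ γ) * (X * 256 ^ γ / ε) < 2 * lam * (X * 256 ^ γ / ε) := by gcongr
    have e1 : ε * (μ ^ γ / 256 ^ γ) * (X * 256 ^ γ / ε) = μ ^ γ * X := by field_simp
    have e2 : 2 * lam * (X * 256 ^ γ / ε) = μ * (2 * 256 ^ γ / ε) := by rw [hμ]; ring
    linarith
  have h2 : μ ^ (γ - 1) * X ≤ 2 * 256 ^ γ / ε := by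
    rw [Real.rpow_sub_one hμ0.ne']
    rw [div_mul_eq_mul_div, div_le_iff₀ hμ0]
    linarith
  have h3 : (μ ^ (γ - 1) * X) ^ γ ≤ (2 * 256 ^ γ / ε) ^ γ :=
    Real.rpow_le_rpow (by positivity) h2 (by linarith)
  rw [Real.mul_rpow (by positivity) hX.le, ← Real.rpow_mul hμ0.le,
    show (γ - 1) * γ = 1 by linarith, Real.rpow_one] at h3
  rw [Real.rpow_add_one hX.ne']
  calc _ = μ * X ^ γ := by rw [hμ]; ring
    _ ≤ _ := h3

lemma round3 (α β : ℝ) (w x z : Fin 3 → ℤ) (W X ρ u1 u2 S : ℝ)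
    (hw1 : 0 ≤ w 1) (hw2 : w 2 ≤ 0) (hx1 : 0 ≤ x 1) (hx2 : x 2 ≤ 0)
    (hW : W = (w 1 : ℝ) - w 2) (hX : X = (x 1 : ℝ) - x 2) (hWX : W < X) (hW0 : 0 < W)
    (hρ : 0 ≤ ρ) (hu1 : u1 = x 1 + ρ * w 1) (hu2 : u2 = x 2 + ρ * w 2)
    (hLu : Lf α β x + ρ * Lf α β w = 0) (hLL : |Lf α β x| ≤ |Lf α β w|)
    (hS : S = (u1 * z 2 - u2 * z 1) / (u1 - u2)) (hSX : 2 * X ≤ S) :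
    ∃ z' : Fin 3 → ℤ, 0 < z' 1 ∧ (z' 1 : ℝ) ≤ 2 * S ∧ 0 < z' 2 ∧ (z' 2 : ℝ) ≤ 2 * S ∧
      |Lf α β z'| ≤ |Lf α β z| + |Lf α β w| := by
  have hw1' : (0 : ℝ) ≤ w 1 := by exact_mod_cast hw1
  have hw2' : (w 2 : ℝ) ≤ 0 := by exact_mod_cast hw2
  have hx1' : (0 : ℝ) ≤ x 1 := by exact_mod_cast hx1
  have hx2' : (x 2 : ℝ) ≤ 0 := by exact_mod_cast hx2
  have hu : 0 < u1 - u2 := by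
    have : u1 - u2 = X + ρ * W := by rw [hu1, hu2, hX, hW]; ring
    rw [this]
    have := mul_nonneg hρ hW0.le
    linarith
  obtain ⟨c1, c2⟩ := coord u1 u2 (z 1) (z 2) hu
  rw [← hS] at c1 c2
  set τ := ((z 1 : ℝ) - z 2) / (u1 - u2) with hτ
  have r1 := abs_sub_round τ
  have r2 := abs_sub_round (τ * ρ)
  set t := round τ
  set t' := round (τ * ρ)
  set d := τ - t with hd
  set d' := τ * ρ - t' with hd'
  have key : ∀ a b : ℝ, |a| ≤ X → |b| ≤ X → |d * a + d' * b| ≤ X := by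
    intro a b ha hb
    calc _ ≤ |d| * |a| + |d'| * |b| := by
            rw [← abs_mul, ← abs_mul]; exact abs_add_le _ _
      _ ≤ 1 / 2 * X + 1 / 2 * X := by gcongr
      _ = X := by ring
  have k1 := abs_le.1 (key (x 1) (w 1) (by rw [abs_le]; constructor <;> linarith)
    (by rw [abs_le]; constructor <;> linarith))
  have k2 := abs_le.1 (key (x 2) (w 2) (by rw [abs_le]; constructor <;> linarith)
    (by rw [abs_le]; constructor <;> linarith))
  have e1 : (z 1 : ℝ) - t * x 1 - t' * w 1 = S + (d * x 1 + d' * w 1) := by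
    rw [c1, hu1, hd, hd']; ring
  have e2 : (z 2 : ℝ) - t * x 2 - t' * w 2 = S + (d * x 2 + d' * w 2) := by
    rw [c2, hu2, hd, hd']; ring
  have eL : Lf α β (fun i => z i - t * x i - t' * w i) =
      Lf α β z + (d * Lf α β x + d' * Lf α β w) := by
    have : Lf α β (fun i => z i - t * x i - t' * w i) =
      Lf α β z - t * Lf α β x - t' * Lf α β w := by simp only [Lf]; push_cast; ring
    rw [this, hd, hd']; linear_combination (-τ) * hLu
  refine ⟨fun i => z i - t * x i - t' * w i, ?_, ?_, ?_, ?_, ?_⟩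
  · rify; linarith
  · push_cast; linarith
  · rify; linarith
  · push_cast; linarith
  · rw [eL]
    calc _ ≤ |Lf α β z| + (|d| * |Lf α β x| + |d'| * |Lf α β w|) := by
            rw [← abs_mul, ← abs_mul]
            exact (abs_add_le _ _).trans (by gcongr; exact abs_add_le _ _)
      _ ≤ |Lf α β z| + (1 / 2 * |Lf α β w| + 1 / 2 * |Lf α β w|) := by gcongr
      _ = _ := by ring

set_option maxHeartbeats 1000000 in
lemma step3 (α β ε X₀ : ℝ) (hε : 0 < ε) (hneg : NegS α β ε X₀) (w x s : Fin 3 → ℤ) (W X : ℝ)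
    (hw1 : 0 ≤ w 1) (hw2 : w 2 ≤ 0) (hx1 : 0 ≤ x 1) (hx2 : x 2 ≤ 0)
    (hW : W = (w 1 : ℝ) - w 2) (hX : X = (x 1 : ℝ) - x 2) (hWX : W < X) (hW0 : 0 < W)
    (hX0 : X₀ ≤ X) (hop : Lf α β w * Lf α β x < 0) (hLL : |Lf α β x| < |Lf α β w|)
    (h16 : |Lf α β w| * X ^ 2 ≤ 16)
    (hs : s 0 * (w 1 * x 2 - w 2 * x 1) + s 1 * (w 2 * x 0 - w 0 * x 2) +
      s 2 * (w 0 * x 1 - w 1 * x 0) = 1) :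
    |Lf α β w| * X ^ (γ + 1) ≤ (2 * 256 ^ γ / ε) ^ γ := by
  have hw1' : (0 : ℝ) ≤ w 1 := by exact_mod_cast hw1
  have hw2' : (w 2 : ℝ) ≤ 0 := by exact_mod_cast hw2
  have hx1' : (0 : ℝ) ≤ x 1 := by exact_mod_cast hx1
  have hx2' : (x 2 : ℝ) ≤ 0 := by exact_mod_cast hx2
  have hX00 : 0 < X := hW0.trans hWX
  have hLw : Lf α β w ≠ 0 := fun h => by simp [h] at hop
  have hlam : 0 < |Lf α β w| := abs_pos.2 hLw
  set lam := |Lf α β w| with hlamdef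
  set ρ := - Lf α β x / Lf α β w with hρ
  have hρ0 : 0 ≤ ρ := by
    have : ρ = -(Lf α β w * Lf α β x) / (Lf α β w) ^ 2 := by rw [hρ]; field_simp
    rw [this]
    apply div_nonneg <;> nlinarith [sq_nonneg (Lf α β w)]
  have hρ1 : ρ ≤ 1 := by
    have : |ρ| ≤ 1 := by
      rw [hρ, abs_div, abs_neg, div_le_one hlam]; exact hLL.le
    exact (abs_le.1 this).2
  have hLu : Lf α β x + ρ * Lf α β w = 0 := by rw [hρ]; field_simp; ring
  set a := round (96 * Lf α β s / Lf α β w) with ha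
  let z : Fin 3 → ℤ := fun i => 96 * s i - a * w i
  have hLz : Lf α β z = 96 * Lf α β s - a * Lf α β w := by
    simp only [Lf, z]; push_cast; ring
  have hLz1 : |Lf α β z| ≤ lam / 2 := by
    have h1 := abs_sub_round (96 * Lf α β s / Lf α β w)
    have : Lf α β z = (96 * Lf α β s / Lf α β w - a) * Lf α β w := by
      rw [hLz]; field_simp
    rw [this, abs_mul]
    calc _ ≤ 1 / 2 * lam := by gcongr
      _ = _ := by ring
  set u1 : ℝ := x 1 + ρ * w 1 with hu1
  set u2 : ℝ := x 2 + ρ * w 2 with hu2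
  set D : ℝ := (w 1 : ℝ) * x 2 - w 2 * x 1 with hD
  set Δ : ℝ := u1 * z 2 - u2 * z 1 with hΔ
  have hDb : |D| ≤ W * X := by
    rw [hD, hW, hX, abs_le]
    constructor <;> nlinarith [mul_nonneg hw1' hx1', mul_nonneg hw1' (neg_nonneg.2 hx2'),
      mul_nonneg (neg_nonneg.2 hw2') hx1', mul_nonneg (neg_nonneg.2 hw2') (neg_nonneg.2 hx2')]
  have hs' : (s 0 : ℝ) * (w 1 * x 2 - w 2 * x 1) + s 1 * (w 2 * x 0 - w 0 * x 2) +
      s 2 * (w 0 * x 1 - w 1 * x 0) = 1 := by exact_mod_cast hs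
  have hid : Lf α β w * Δ = 96 - Lf α β z * D := by
    have h1 : Lf α β w * Δ = Lf α β w * ((x 1 : ℝ) * z 2 - x 2 * z 1)
        - Lf α β x * ((w 1 : ℝ) * z 2 - w 2 * z 1) := by
      rw [hΔ, hu1, hu2]; linear_combination ((w 1 : ℝ) * z 2 - w 2 * z 1) * hLu
    rw [h1, hD]
    simp only [Lf, z]; push_cast
    linear_combination 96 * hs'
  have hsmall : |Lf α β z * D| ≤ 8 := by
    rw [abs_mul]
    calc _ ≤ lam / 2 * (W * X) := by gcongr
      _ ≤ lam / 2 * (X * X) := by gcongr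
      _ ≤ 8 := by
        have : lam / 2 * (X * X) = lam * X ^ 2 / 2 := by ring
        linarith
  have hΔb : 88 ≤ lam * |Δ| ∧ lam * |Δ| ≤ 104 := by
    have := abs_le.1 hsmall
    have h1 : lam * |Δ| = 96 - Lf α β z * D := by
      rw [hlamdef, ← abs_mul, hid, abs_of_nonneg]; linarith
    rw [h1]; constructor <;> linarith
  have hul : u1 - u2 = X + ρ * W := by rw [hu1, hu2, hX, hW]; ring
  have hρW : 0 ≤ ρ * W := mul_nonneg hρ0 hW0.le
  have hρW' : ρ * W ≤ W := mul_le_of_le_one_left hW0.le hρ1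
  have hu0 : 0 < u1 - u2 := by linarith
  -- the size of the new point
  have hS2 : 2 * X ≤ |Δ| / (u1 - u2) := by
    rw [le_div_iff₀ hu0]
    have h1 : lam * (2 * X * (u1 - u2)) ≤ lam * (2 * X * (2 * X)) := by
      have : u1 - u2 ≤ 2 * X := by linarith
      gcongr
    have h2 : lam * (2 * X * (u1 - u2)) ≤ lam * |Δ| := by
      have : lam * (2 * X * (2 * X)) = 4 * (lam * X ^ 2) := by ring
      linarith [hΔb.1]
    exact le_of_mul_le_mul_left h2 hlam
  have hS3 : 2 * (|Δ| / (u1 - u2)) ≤ 256 / (lam * X) := by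
    rw [← mul_div_assoc, div_le_div_iff₀ hu0 (by positivity)]
    have h1 : X ≤ u1 - u2 := by linarith
    have h2 : lam * |Δ| * X ≤ 104 * X := by gcongr; exact hΔb.2
    linarith
  have hT : X₀ ≤ 256 / (lam * X) := by linarith
  obtain ⟨z', p1, p2, p3, p4, p5⟩ : ∃ z' : Fin 3 → ℤ, 0 < z' 1 ∧
      (z' 1 : ℝ) ≤ 2 * (|Δ| / (u1 - u2)) ∧ 0 < z' 2 ∧ (z' 2 : ℝ) ≤ 2 * (|Δ| / (u1 - u2)) ∧
      |Lf α β z'| ≤ |Lf α β z| + |Lf α β w| := by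
    rcases le_total 0 Δ with hpos | hpos
    · refine round3 α β w x z W X ρ u1 u2 _ hw1 hw2 hx1 hx2 hW hX hWX hW0 hρ0 hu1 hu2 hLu hLL.le
        ?_ hS2
      rw [abs_of_nonneg hpos]
    · rw [← abs_neg (Lf α β z), ← Lf_neg]
      refine round3 α β w x (-z) W X ρ u1 u2 _ hw1 hw2 hx1 hx2 hW hX hWX hW0 hρ0 hu1 hu2 hLu hLL.le
        ?_ hS2
      rw [abs_of_nonpos hpos, hΔ]
      simp only [Pi.neg_apply]; push_cast; ring
  have := hneg _ hT z' p1 (p2.trans hS3) p3 (p4.trans hS3)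
  apply analytic3 ε lam X hε hlam hX00
  have : lam = |Lf α β w| := rfl
  linarith

lemma step2 (α β ε X₀ : ℝ) (hneg : NegS α β ε X₀) (v x : Fin 3 → ℤ) (V X K : ℝ)
    (hw1 : 0 ≤ v 1) (hw2 : v 2 ≤ 0) (hx1 : 0 ≤ x 1) (hx2 : x 2 ≤ 0)
    (hV : V = (v 1 : ℝ) - v 2) (hX : X = (x 1 : ℝ) - x 2) (hVX : V < X) (hV0 : 0 < V)
    (hX0 : X₀ ≤ X) (hLL : |Lf α β x| < |Lf α β v|)
    (hK : |Lf α β v| * X ^ (γ + 1) ≤ K)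
    (hD : 2 * V ^ 2 ≤ |(v 1 : ℝ) * x 2 - v 2 * x 1|) :
    V * ε ≤ 3 * K * 2 ^ γ := by
  have hw1' : (0 : ℝ) ≤ v 1 := by exact_mod_cast hw1
  have hw2' : (v 2 : ℝ) ≤ 0 := by exact_mod_cast hw2
  have hx1' : (0 : ℝ) ≤ x 1 := by exact_mod_cast hx1
  have hx2' : (x 2 : ℝ) ≤ 0 := by exact_mod_cast hx2
  have hX00 : 0 < X := hV0.trans hVX
  set D : ℝ := (v 1 : ℝ) * x 2 - v 2 * x 1 with hDdef
  have hDb : |D| ≤ V * X := by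
    rw [hDdef, hV, hX, abs_le]
    constructor <;> nlinarith [mul_nonneg hw1' hx1', mul_nonneg hw1' (neg_nonneg.2 hx2'),
      mul_nonneg (neg_nonneg.2 hw2') hx1', mul_nonneg (neg_nonneg.2 hw2') (neg_nonneg.2 hx2')]
  obtain ⟨z, hz1, hz2, hz3⟩ : ∃ z : Fin 3 → ℤ, (v 1 : ℝ) * z 2 - v 2 * z 1 = |D| ∧
      |(z 1 : ℝ) - z 2| = X ∧ |Lf α β z| = |Lf α β x| := by
    rcases le_total 0 D with hpos | hpos
    · exact ⟨x, (abs_of_nonneg hpos).symm, by rw [← hX, abs_of_pos hX00], rfl⟩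
    · refine ⟨-x, ?_, ?_, by rw [Lf_neg, abs_neg]⟩
      · rw [abs_of_nonpos hpos, hDdef]; simp only [Pi.neg_apply]; push_cast; ring
      · have : (((-x) 1 : ℤ) : ℝ) - ((-x) 2 : ℤ) = - X := by
          rw [hX]; simp only [Pi.neg_apply]; push_cast; ring
        rw [this, abs_neg, abs_of_pos hX00]
  obtain ⟨c1, c2⟩ := coord (v 1) (v 2) (z 1) (z 2) (by rw [← hV]; exact hV0)
  rw [← hV, hz1] at c1 c2
  set S := |D| / V with hS
  have hS1 : 2 * V ≤ S := by rw [hS, le_div_iff₀ hV0]; linarith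
  have hS2 : S ≤ X := by rw [hS, div_le_iff₀ hV0]; linarith
  set τ := ((z 1 : ℝ) - z 2) / V with hτ
  have hτb : |τ| = X / V := by rw [hτ, abs_div, hz2, abs_of_pos hV0]
  have r1 := abs_sub_round τ
  set t := round τ
  set d := τ - t with hd
  have key : ∀ a : ℝ, |a| ≤ V → |d * a| ≤ V := by
    intro a ha
    rw [abs_mul]
    calc _ ≤ 1 / 2 * V := by gcongr
      _ ≤ V := by linarith
  have k1 := abs_le.1 (key (v 1) (by rw [abs_le]; constructor <;> linarith))
  have k2 := abs_le.1 (key (v 2) (by rw [abs_le]; constructor <;> linarith))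
  have e1 : (z 1 : ℝ) - t * v 1 = S + d * v 1 := by
    rw [hd]; linear_combination c1
  have e2 : (z 2 : ℝ) - t * v 2 = S + d * v 2 := by
    rw [hd]; linear_combination c2
  have eL : Lf α β (fun i => z i - t * v i) = Lf α β z - t * Lf α β v := by
    simp only [Lf]; push_cast; ring
  have htb : |(t : ℝ)| ≤ X / V + 1 / 2 := by
    have : (t : ℝ) = τ - d := by rw [hd]; ring
    rw [this, ← hτb]
    exact (abs_sub _ _).trans (by gcongr)
  have hXV : 1 ≤ X / V := by rw [le_div_iff₀ hV0]; linarith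
  have hn := hneg (2 * X) (by linarith) (fun i => z i - t * v i) (by rify; linarith)
    (by push_cast; linarith) (by rify; linarith) (by push_cast; linarith)
  have hLb : |Lf α β (fun i => z i - t * v i)| ≤ 3 * (X / V) * |Lf α β v| := by
    rw [eL]
    calc _ ≤ |Lf α β z| + |(t : ℝ)| * |Lf α β v| := by
            rw [← abs_mul]; exact abs_sub _ _
      _ ≤ |Lf α β v| + (X / V + 1 / 2) * |Lf α β v| := by rw [hz3]; gcongr
      _ = (1 + (X / V + 1 / 2)) * |Lf α β v| := by ring
      _ ≤ 3 * (X / V) * |Lf α β v| := by gcongr; linarith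
  have h1 := hn.trans_le hLb
  have h2X : 0 < (2 * X) ^ γ := by positivity
  rw [Real.rpow_neg (by positivity), ← div_eq_mul_inv, div_lt_iff₀ h2X,
    Real.mul_rpow (by norm_num) hX00.le] at h1
  rw [Real.rpow_add_one hX00.ne'] at hK
  calc V * ε ≤ V * (3 * (X / V) * |Lf α β v| * (2 ^ γ * X ^ γ)) := by gcongr
    _ = 3 * (|Lf α β v| * (X ^ γ * X)) * 2 ^ γ := by field_simp
    _ ≤ 3 * K * 2 ^ γ := by gcongr

lemma centered (a p : ℤ) (hp : 0 < p) : ∃ r : ℤ, 2 * |r| ≤ p ∧ p ∣ a - r := by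
  have h1 := Int.emod_nonneg a hp.ne'
  have h2 := Int.emod_lt_of_pos a hp
  have h3 : p ∣ a - a % p := Int.dvd_self_sub_emod
  by_cases h : 2 * (a % p) ≤ p
  · exact ⟨a % p, by rw [abs_of_nonneg h1]; exact h, h3⟩
  · refine ⟨a % p - p, by rw [abs_of_nonpos (by linarith)]; linarith, ?_⟩
    have : a - (a % p - p) = (a - a % p) + p := by ring
    rw [this]
    exact dvd_add h3 (dvd_refl p)

lemma hN_eq (x : Fin 3 → ℤ) (h1 : 0 ≤ x 1) (h2 : x 2 ≤ 0) : hN x = x 1 - x 2 := by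
  apply le_antisymm
  · rw [hN_le_iff]
    simp only [abs_le]
    omega
  · exact (le_abs_self _).trans (le_max_right _ _)

lemma no_small (α β : ℝ) (w x q : Fin 3 → ℤ)
    (hWX : hN w < hN x) (hLL : |Lf α β x| < |Lf α β w|)
    (hmin : ∀ q : Fin 3 → ℤ, q ≠ 0 → hN q < hN x → |Lf α β w| ≤ |Lf α β q|)
    (p a b : ℤ) (hp : 0 < p) (ha : 2 * |a| ≤ p) (hb : 2 * |b| ≤ p) (hq0 : q ≠ 0)
    (hq : ∀ i, p * q i = a * w i + b * x i) : False := by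
  have hpR : (0 : ℝ) < p := by exact_mod_cast hp
  have haR : 2 * |(a : ℝ)| ≤ p := by exact_mod_cast ha
  have hbR : 2 * |(b : ℝ)| ≤ p := by exact_mod_cast hb
  have hqR : ∀ i, (p : ℝ) * q i = a * w i + b * x i := by intro i; exact_mod_cast hq i
  obtain ⟨w1, w2, w3⟩ := (hN_le_iff w _).1 le_rfl
  obtain ⟨x1, x2, x3⟩ := (hN_le_iff x _).1 le_rfl
  have key : ∀ c d e : ℤ, p * c = a * d + b * e → |d| ≤ hN w → |e| ≤ hN x → |c| < hN x := by
    intro c d e h hd he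
    have h1 : p * |c| ≤ |a| * |d| + |b| * |e| := by
      rw [← abs_of_pos hp, ← abs_mul, h, ← abs_mul, ← abs_mul]
      exact abs_add_le _ _
    have h2 : |a| * |d| ≤ |a| * hN w := by gcongr
    have h3 : |b| * |e| ≤ |b| * hN x := by gcongr
    have h4 : 2 * |a| * hN w ≤ p * hN w := mul_le_mul_of_nonneg_right ha (hN_nonneg w)
    have h5 : 2 * |b| * hN x ≤ p * hN x := mul_le_mul_of_nonneg_right hb (hN_nonneg x)
    have h6 : p * hN w < p * hN x := by gcongr
    have h7 : p * |c| < p * hN x := by linarith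
    exact lt_of_mul_lt_mul_left h7 hp.le
  have hqs : hN q < hN x := by
    rw [hN_lt_iff]
    refine ⟨key _ _ _ (hq 1) w1 x1, key _ _ _ (hq 2) w2 x2, key _ _ _ ?_ w3 x3⟩
    linear_combination hq 1 - hq 2
  have h1 := hmin q hq0 hqs
  have h2 : (p : ℝ) * Lf α β q = a * Lf α β w + b * Lf α β x := by
    simp only [Lf]; linear_combination hqR 0 + α * hqR 1 + β * hqR 2
  have h3 : (p : ℝ) * |Lf α β q| ≤ |(a : ℝ)| * |Lf α β w| + |(b : ℝ)| * |Lf α β x| := by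
    rw [← abs_of_pos hpR, ← abs_mul, h2, ← abs_mul, ← abs_mul]
    exact abs_add_le _ _
  have h4 : 2 * |(a : ℝ)| * |Lf α β w| ≤ p * |Lf α β w| := by gcongr
  have h5 : 2 * |(b : ℝ)| * |Lf α β x| ≤ p * |Lf α β x| := by gcongr
  have h6 : (p : ℝ) * |Lf α β x| < p * |Lf α β w| := by gcongr
  have h7 : (p : ℝ) * |Lf α β w| ≤ p * |Lf α β q| := by gcongr
  linarith

lemma prim (α β : ℝ) (w x : Fin 3 → ℤ) (hw0 : w ≠ 0)
    (hw1 : 0 ≤ w 1) (hw2 : w 2 ≤ 0) (hx1 : 0 ≤ x 1) (hx2 : x 2 ≤ 0)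
    (hWX : hN w < hN x) (hLL : |Lf α β x| < |Lf α β w|)
    (hmin : ∀ q : Fin 3 → ℤ, q ≠ 0 → hN q < hN x → |Lf α β w| ≤ |Lf α β q|) :
    ∃ s : Fin 3 → ℤ, s 0 * (w 1 * x 2 - w 2 * x 1) + s 1 * (w 2 * x 0 - w 0 * x 2) +
      s 2 * (w 0 * x 1 - w 1 * x 0) = 1 := by
  set n0 := w 1 * x 2 - w 2 * x 1 with hn0
  set n1 := w 2 * x 0 - w 0 * x 2 with hn1
  set n2 := w 0 * x 1 - w 1 * x 0 with hn2
  set g := Int.gcd n0 (Int.gcd n1 n2) with hg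
  by_cases hg1 : g = 1
  · have e1 := Int.gcd_eq_gcd_ab n0 (Int.gcd n1 n2)
    have e2 := Int.gcd_eq_gcd_ab n1 n2
    rw [← hg, hg1] at e1
    refine ⟨![Int.gcdA n0 (Int.gcd n1 n2), Int.gcdB n0 (Int.gcd n1 n2) * Int.gcdA n1 n2,
      Int.gcdB n0 (Int.gcd n1 n2) * Int.gcdB n1 n2], ?_⟩
    simp only [Matrix.cons_val]
    push_cast at e1
    linear_combination -e1 - Int.gcdB n0 (Int.gcd n1 n2) * e2
  exfalso
  obtain ⟨p, hp, hpg⟩ := Nat.exists_prime_and_dvd hg1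
  have hpg' : (p : ℤ) ∣ (g : ℤ) := by exact_mod_cast hpg
  have hp0 : (p : ℤ) ∣ n0 := hpg'.trans (Int.gcd_dvd_left _ _)
  have hp12 : (p : ℤ) ∣ (Int.gcd n1 n2 : ℤ) := hpg'.trans (Int.gcd_dvd_right _ _)
  have hp1 : (p : ℤ) ∣ n1 := hp12.trans (Int.gcd_dvd_left _ _)
  have hp2 : (p : ℤ) ∣ n2 := hp12.trans (Int.gcd_dvd_right _ _)
  have hp2' : (2 : ℤ) ≤ p := by exact_mod_cast hp.two_le
  have hppos : (0 : ℤ) < p := by linarith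
  by_cases hall : ∀ i, (p : ℤ) ∣ w i
  · choose q hq using hall
    refine no_small α β w x q hWX hLL hmin p 1 0 hppos (by simpa using hp2') (by simp) ?_ ?_
    · rintro rfl
      apply hw0
      ext i
      simpa using hq i
    · intro i
      rw [← hq i]; ring
  · push Not at hall
    obtain ⟨k, hk⟩ := hall
    obtain ⟨a, ha, had⟩ := centered (-x k) p hppos
    obtain ⟨b, hb, hbd⟩ := centered (w k) p hppos
    have hdiv : ∀ i, (p : ℤ) ∣ w k * x i - x k * w i := by
      have m0 := Int.dvd_neg.2 hp0
      have m1 := Int.dvd_neg.2 hp1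
      have m2 := Int.dvd_neg.2 hp2
      intro i
      fin_cases k <;> fin_cases i <;> simp only [Fin.zero_eta, Fin.mk_one, Fin.reduceFinMk]
      · rw [mul_comm, sub_self]; exact dvd_zero _
      · convert hp2 using 1; rw [hn2]; ring
      · convert m1 using 1; rw [hn1]; ring
      · convert m2 using 1; rw [hn2]; ring
      · rw [mul_comm, sub_self]; exact dvd_zero _
      · convert hp0 using 1; rw [hn0]; ring
      · convert hp1 using 1; rw [hn1]; ring
      · convert m0 using 1; rw [hn0]; ring
      · rw [mul_comm, sub_self]; exact dvd_zero _
    have hdiv2 : ∀ i, (p : ℤ) ∣ a * w i + b * x i := by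
      intro i
      have : a * w i + b * x i = (w k * x i - x k * w i) - (-x k - a) * w i - (w k - b) * x i := by
        ring
      rw [this]
      exact dvd_sub (dvd_sub (hdiv i) (had.mul_right _)) (hbd.mul_right _)
    have hb0 : b ≠ 0 := by
      rintro rfl
      apply hk
      simpa using hbd
    choose q hq using hdiv2
    refine no_small α β w x q hWX hLL hmin p a b hppos ha hb ?_ (fun i => (hq i).symm)
    rintro rfl
    have z0 : ∀ i, a * w i + b * x i = 0 := by intro i; rw [hq i]; simp
    have z0R : ∀ i, (a : ℝ) * w i + b * x i = 0 := by intro i; exact_mod_cast z0 i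
    have l1 : (a : ℝ) * Lf α β w = - (b * Lf α β x) := by
      simp only [Lf]; linear_combination z0R 0 + α * z0R 1 + β * z0R 2
    have l2 : |(a : ℝ)| * |Lf α β w| = |(b : ℝ)| * |Lf α β x| := by
      rw [← abs_mul, ← abs_mul, l1, abs_neg]
    have l3 : a * hN w = - (b * hN x) := by
      rw [hN_eq w hw1 hw2, hN_eq x hx1 hx2]; linear_combination z0 1 - z0 2
    have l4 : |a| * hN w = |b| * hN x := by
      rw [← abs_of_nonneg (hN_nonneg w), ← abs_of_nonneg (hN_nonneg x), ← abs_mul, ← abs_mul, l3,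
        abs_neg]
    have hbp : 0 < |b| := abs_pos.2 hb0
    have hbpR : (0 : ℝ) < |(b : ℝ)| := by exact_mod_cast hbp
    have l5 : |(a : ℝ)| * |Lf α β w| < |(b : ℝ)| * |Lf α β w| := by
      rw [l2]; gcongr
    have l6 : |(a : ℝ)| < |(b : ℝ)| := lt_of_mul_lt_mul_right l5 (abs_nonneg _)
    have l7 : |a| < |b| := by exact_mod_cast l6
    have l8 : |a| * hN w ≤ |b| * hN w := mul_le_mul_of_nonneg_right l7.le (hN_nonneg w)
    have l9 : |b| * hN w < |b| * hN x := by gcongr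
    linarith

lemma opposite (α β ε X₀ : ℝ) (hneg : NegS α β ε X₀) (w x : Fin 3 → ℤ)
    (hL : ∀ q : Fin 3 → ℤ, q ≠ 0 → Lf α β q ≠ 0) (hw0 : w ≠ 0) (hx0 : x ≠ 0)
    (hw1 : 0 ≤ w 1) (hw2 : w 2 ≤ 0) (hx1 : 0 ≤ x 1) (hx2 : x 2 ≤ 0) (hW0 : 0 < hN w)
    (hWX : hN w < hN x) (hLL : |Lf α β x| < |Lf α β w|)
    (hmin : ∀ q : Fin 3 → ℤ, q ≠ 0 → hN q < hN x → |Lf α β w| ≤ |Lf α β q|)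
    (hX0 : X₀ ≤ hN x) (hsm : |Lf α β w| ≤ ε * (hN x : ℝ) ^ (-γ)) :
    Lf α β w * Lf α β x < 0 := by
  by_contra hcon
  have hpos : 0 < Lf α β w * Lf α β x :=
    lt_of_le_of_ne (not_lt.1 hcon) (mul_ne_zero (hL w hw0) (hL x hx0)).symm
  have eX := hN_eq x hx1 hx2
  have eW := hN_eq w hw1 hw2
  have hLq : Lf α β (x - w) = Lf α β x - Lf α β w := by
    simp only [Lf, Pi.sub_apply]; push_cast; ring
  have hlt : |Lf α β (x - w)| < |Lf α β w| := by
    rw [hLq]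
    rcases pos_and_pos_or_neg_and_neg_of_mul_pos hpos with ⟨a, b⟩ | ⟨a, b⟩
    · rw [abs_of_pos a, abs_of_pos b] at hLL
      rw [abs_of_pos a, abs_lt]; constructor <;> linarith
    · rw [abs_of_neg a, abs_of_neg b] at hLL
      rw [abs_of_neg a, abs_lt]; constructor <;> linarith
  have hq0 : x - w ≠ 0 := by
    intro h
    rw [sub_eq_zero] at h
    rw [h] at hWX
    exact lt_irrefl _ hWX
  have hge : ¬ hN (x - w) < hN x := fun h => absurd (hmin _ hq0 h) (not_le.2 hlt)
  rw [hN_lt_iff] at hge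
  simp only [abs_lt, Pi.sub_apply] at hge
  have hcase : (0 < x 1 - w 1 ∧ 0 < x 2 - w 2) ∨ (0 < w 1 - x 1 ∧ 0 < w 2 - x 2) := by omega
  rcases hcase with ⟨c1, c2⟩ | ⟨c1, c2⟩
  · have h1 : x 1 - w 1 ≤ hN x := by omega
    have h2 : x 2 - w 2 ≤ hN x := by omega
    have := hneg (hN x) hX0 (x - w) c1 (by exact_mod_cast h1) c2 (by exact_mod_cast h2)
    linarith
  · have h1 : w 1 - x 1 ≤ hN x := by omega
    have h2 : w 2 - x 2 ≤ hN x := by omega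
    have := hneg (hN x) hX0 (w - x) c1 (by exact_mod_cast h1) c2 (by exact_mod_cast h2)
    rw [← neg_sub, Lf_neg, abs_neg] at this
    linarith

lemma par (α β : ℝ) (w x y s : Fin 3 → ℤ)
    (hs : s 0 * (w 1 * x 2 - w 2 * x 1) + s 1 * (w 2 * x 0 - w 0 * x 2) +
      s 2 * (w 0 * x 1 - w 1 * x 0) = 1) (hdet : det3Z w x y = 0) :
    ∃ c : ℤ, Lf α β x * ((y 1 : ℝ) - y 2) - Lf α β y * ((x 1 : ℝ) - x 2) =
      c * (Lf α β w * ((x 1 : ℝ) - x 2) - Lf α β x * ((w 1 : ℝ) - w 2)) := by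
  unfold det3Z at hdet
  set c : ℤ := s 0 * (x 1 * y 2 - x 2 * y 1) + s 1 * (x 2 * y 0 - x 0 * y 2) +
      s 2 * (x 0 * y 1 - x 1 * y 0) with hc
  have e0 : x 1 * y 2 - x 2 * y 1 = c * (w 1 * x 2 - w 2 * x 1) := by
    rw [hc]
    linear_combination (-(x 1 * y 2 - x 2 * y 1)) * hs + (- s 1 * x 2 + s 2 * x 1) * hdet
  have e1 : x 2 * y 0 - x 0 * y 2 = c * (w 2 * x 0 - w 0 * x 2) := by
    rw [hc]
    linear_combination (-(x 2 * y 0 - x 0 * y 2)) * hs + (s 0 * x 2 - s 2 * x 0) * hdet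
  have e2 : x 0 * y 1 - x 1 * y 0 = c * (w 0 * x 1 - w 1 * x 0) := by
    rw [hc]
    linear_combination (-(x 0 * y 1 - x 1 * y 0)) * hs + (- s 0 * x 1 + s 1 * x 0) * hdet
  have e0' : (x 1 : ℝ) * y 2 - x 2 * y 1 = c * (w 1 * x 2 - w 2 * x 1) := by exact_mod_cast e0
  have e1' : (x 2 : ℝ) * y 0 - x 0 * y 2 = c * (w 2 * x 0 - w 0 * x 2) := by exact_mod_cast e1
  have e2' : (x 0 : ℝ) * y 1 - x 1 * y 0 = c * (w 0 * x 1 - w 1 * x 0) := by exact_mod_cast e2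
  refine ⟨c, ?_⟩
  simp only [Lf]
  linear_combination e2' + e1' - (α + β) * e0'

lemma threshold (ε K X₀ : ℝ) (hε : 0 < ε) : ∃ B : ℝ, ∀ X : ℝ, B ≤ X →
    X₀ ≤ X ∧ 3 ≤ X ∧ 16 / X ^ 2 ≤ ε * X ^ (-γ) ∧ 4 * K ≤ X ^ (γ - 1) ∧ 3 * K * 2 ^ γ < X * ε := by
  have g1 := gam_gt
  have g2 := gam_lt
  have t1 : ∀ᶠ X : ℝ in Filter.atTop, 16 / ε ≤ X ^ (2 - γ) :=
    (tendsto_rpow_atTop (by linarith)).eventually_ge_atTop _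
  have t2 : ∀ᶠ X : ℝ in Filter.atTop, 4 * K ≤ X ^ (γ - 1) :=
    (tendsto_rpow_atTop (by linarith)).eventually_ge_atTop _
  have t3 : ∀ᶠ X : ℝ in Filter.atTop, 3 * K * 2 ^ γ < X * ε :=
    (Filter.tendsto_id.atTop_mul_const hε).eventually_gt_atTop _
  have t4 := Filter.eventually_ge_atTop X₀
  have t5 := Filter.eventually_ge_atTop (3 : ℝ)
  obtain ⟨B, hB⟩ := Filter.eventually_atTop.1 (t1.and (t2.and (t3.and (t4.and t5))))
  refine ⟨B, fun X hX => ?_⟩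
  obtain ⟨a1, a2, a3, a4, a5⟩ := hB X hX
  refine ⟨a4, a5, ?_, a2, a3⟩
  have hX0 : 0 < X := by linarith
  have hp : 0 < X ^ γ := by positivity
  rw [Real.rpow_sub hX0, Real.rpow_two, div_le_div_iff₀ hε hp] at a1
  rw [Real.rpow_neg hX0.le, ← div_eq_mul_inv, div_le_div_iff₀ (by positivity) hp]
  linarith

lemma quarter (lam X K : ℝ) (hX : 0 < X) (hl : 0 ≤ lam) (h : lam * X ^ (γ + 1) ≤ K)
    (h4 : 4 * K ≤ X ^ (γ - 1)) : lam * X ^ 2 ≤ 1 / 4 := by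
  have e : X ^ (γ + 1) = X ^ (γ - 1) * X ^ 2 := by
    rw [← Real.rpow_two, ← Real.rpow_add hX]; congr 1; ring
  have hp : 0 < X ^ (γ - 1) := by positivity
  rw [e] at h
  have : X ^ (γ - 1) * (lam * X ^ 2) ≤ X ^ (γ - 1) * (1 / 4) := by linarith
  exact le_of_mul_le_mul_left this hp

lemma D_bound (w x : Fin 3 → ℤ)
    (hw1 : 0 ≤ w 1) (hw2 : w 2 ≤ 0) (hx1 : 0 ≤ x 1) (hx2 : x 2 ≤ 0) :
    |(w 1 : ℝ) * x 2 - w 2 * x 1| ≤ hN w * hN x := by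
  have hw1' : (0 : ℝ) ≤ w 1 := by exact_mod_cast hw1
  have hw2' : (w 2 : ℝ) ≤ 0 := by exact_mod_cast hw2
  have hx1' : (0 : ℝ) ≤ x 1 := by exact_mod_cast hx1
  have hx2' : (x 2 : ℝ) ≤ 0 := by exact_mod_cast hx2
  rw [hN_eq w hw1 hw2, hN_eq x hx1 hx2, abs_le]
  push_cast
  constructor <;> nlinarith [mul_nonneg hw1' hx1', mul_nonneg hw1' (neg_nonneg.2 hx2'),
      mul_nonneg (neg_nonneg.2 hw2') hx1', mul_nonneg (neg_nonneg.2 hw2') (neg_nonneg.2 hx2')]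

lemma det_bound (α β : ℝ) (p v x : Fin 3 → ℤ)
    (hp1 : 0 ≤ p 1) (hp2 : p 2 ≤ 0) (hv1 : 0 ≤ v 1) (hv2 : v 2 ≤ 0)
    (hx1 : 0 ≤ x 1) (hx2 : x 2 ≤ 0) (hpv : hN p < hN v) (hvx : hN v < hN x)
    (hLp : 0 < |Lf α β p|) (hLL : |Lf α β x| < |Lf α β v|)
    (q1 : |Lf α β p| * (hN v : ℝ) ^ 2 ≤ 1 / 4) (q2 : |Lf α β v| * (hN x : ℝ) ^ 2 ≤ 1 / 4)
    (hdet : det3Z p v x ≠ 0) :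
    2 * (hN v : ℝ) ^ 2 ≤ |(v 1 : ℝ) * x 2 - v 2 * x 1| := by
  have hpv' : (hN p : ℝ) ≤ hN v := by exact_mod_cast hpv.le
  have hvx' : (hN v : ℝ) ≤ hN x := by exact_mod_cast hvx.le
  have hP0 : (0 : ℝ) ≤ hN p := by exact_mod_cast hN_nonneg p
  have hV0 : (0 : ℝ) ≤ hN v := hP0.trans hpv'
  have hX0 : (0 : ℝ) ≤ hN x := hV0.trans hvx'
  have b1 := D_bound p x hp1 hp2 hx1 hx2
  have b2 := D_bound p v hp1 hp2 hv1 hv2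
  have hd : (1 : ℝ) ≤ |(det3Z p v x : ℝ)| := by exact_mod_cast Int.one_le_abs hdet
  have e : (det3Z p v x : ℝ) = Lf α β p * ((v 1 : ℝ) * x 2 - v 2 * x 1)
      - Lf α β v * ((p 1 : ℝ) * x 2 - p 2 * x 1) + Lf α β x * ((p 1 : ℝ) * v 2 - p 2 * v 1) := by
    simp only [det3Z, Lf]; push_cast; ring
  have c1 : |Lf α β v * ((p 1 : ℝ) * x 2 - p 2 * x 1)| ≤ 1 / 4 := by
    rw [abs_mul]
    calc _ ≤ |Lf α β v| * (hN x * hN x) := by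
            gcongr
            exact b1.trans (by gcongr; linarith)
      _ ≤ 1 / 4 := by rw [← sq]; exact q2
  have c2 : |Lf α β x * ((p 1 : ℝ) * v 2 - p 2 * v 1)| ≤ 1 / 4 := by
    rw [abs_mul]
    calc _ ≤ |Lf α β v| * (hN x * hN x) := by
            gcongr
            exact b2.trans (by gcongr; linarith)
      _ ≤ 1 / 4 := by rw [← sq]; exact q2
  have c3 : 1 / 2 ≤ |Lf α β p| * |(v 1 : ℝ) * x 2 - v 2 * x 1| := by
    rw [← abs_mul]
    rw [e] at hd
    have := abs_add_le (Lf α β p * ((v 1 : ℝ) * x 2 - v 2 * x 1)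
      - Lf α β v * ((p 1 : ℝ) * x 2 - p 2 * x 1)) (Lf α β x * ((p 1 : ℝ) * v 2 - p 2 * v 1))
    have := abs_sub (Lf α β p * ((v 1 : ℝ) * x 2 - v 2 * x 1))
      (Lf α β v * ((p 1 : ℝ) * x 2 - p 2 * x 1))
    linarith
  have c4 : |Lf α β p| * (2 * (hN v : ℝ) ^ 2) ≤ |Lf α β p| * |(v 1 : ℝ) * x 2 - v 2 * x 1| := by
    linarith
  exact le_of_mul_le_mul_left c4 hLp

lemma normalize_seq (α β ε X₀ B : ℝ) (hneg : NegS α β ε X₀)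
    (hB : ∀ X : ℝ, B ≤ X → X₀ ≤ X ∧ 3 ≤ X ∧ 16 / X ^ 2 ≤ ε * X ^ (-γ))
    (hL : ∀ q : Fin 3 → ℤ, q ≠ 0 → Lf α β q ≠ 0) :
    ∃ y : ℕ → Fin 3 → ℤ, ∀ k, y k ≠ 0 ∧ 0 ≤ y k 1 ∧ y k 2 ≤ 0 ∧ B ≤ hN (y k) ∧
      hN (y k) < hN (y (k + 1)) ∧ |Lf α β (y (k + 1))| < |Lf α β (y k)| ∧
      (∀ q : Fin 3 → ℤ, q ≠ 0 → hN q < hN (y (k + 1)) → |Lf α β (y k)| ≤ |Lf α β q|) ∧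
      |Lf α β (y k)| * (hN (y (k + 1)) : ℝ) ^ 2 ≤ 16 := by
  obtain ⟨x, hx⟩ := exists_seq α β hL
  have hgrow : ∀ k : ℕ, (k : ℤ) ≤ hN (x k) := by
    intro k
    induction k with
    | zero => exact hN_nonneg _
    | succ k ih => have := (hx k).2.1; push_cast; omega
  obtain ⟨k0, hk0⟩ := exists_nat_ge B
  have hbig : ∀ k, B ≤ hN (x (k0 + k)) := by
    intro k
    have h1 := hgrow (k0 + k)
    have h2 : ((k0 + k : ℕ) : ℝ) ≤ hN (x (k0 + k)) := by exact_mod_cast h1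
    push_cast at h2
    have : (0 : ℝ) ≤ k := by positivity
    linarith
  have h16 : ∀ k, |Lf α β (x (k0 + k))| * (hN (x (k0 + k + 1)) : ℝ) ^ 2 ≤ 16 := by
    intro k
    apply seq_bound
    · exact_mod_cast (hB _ (hbig (k + 1))).2.1
    · exact (hx (k0 + k)).2.2.2
  have hsgn : ∀ k, ∃ y : Fin 3 → ℤ, y ≠ 0 ∧ 0 ≤ y 1 ∧ y 2 ≤ 0 ∧ hN y = hN (x (k0 + k)) ∧
      |Lf α β y| = |Lf α β (x (k0 + k))| := by
    intro k
    obtain ⟨b1, b2, b3⟩ := hB _ (hbig k)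
    have hsm : |Lf α β (x (k0 + k))| ≤ ε * (hN (x (k0 + k)) : ℝ) ^ (-γ) := by
      refine le_trans ?_ b3
      have hlt : (hN (x (k0 + k)) : ℝ) ≤ hN (x (k0 + k + 1)) := by
        exact_mod_cast (hx (k0 + k)).2.1.le
      rw [le_div_iff₀ (by positivity)]
      refine le_trans ?_ (h16 k)
      gcongr
    set z := x (k0 + k) with hz
    obtain ⟨a1, a2, -⟩ := (hN_le_iff z _).1 le_rfl
    have n1 : ¬ (0 < z 1 ∧ 0 < z 2) := by
      rintro ⟨c1, c2⟩
      have h1 : z 1 ≤ hN z := (le_abs_self _).trans a1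
      have h2 : z 2 ≤ hN z := (le_abs_self _).trans a2
      have := hneg _ b1 z c1 (by exact_mod_cast h1) c2 (by exact_mod_cast h2)
      linarith
    have n2 : ¬ (z 1 < 0 ∧ z 2 < 0) := by
      rintro ⟨c1, c2⟩
      have h1 : (-z) 1 ≤ hN z := (neg_le_abs _).trans a1
      have h2 : (-z) 2 ≤ hN z := (neg_le_abs _).trans a2
      have := hneg _ b1 (-z) (by simpa using c1) (by exact_mod_cast h1) (by simpa using c2)
        (by exact_mod_cast h2)
      rw [Lf_neg, abs_neg] at this
      linarith
    have hcase : (0 ≤ z 1 ∧ z 2 ≤ 0) ∨ (z 1 ≤ 0 ∧ 0 ≤ z 2) := by omega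
    rcases hcase with ⟨c1, c2⟩ | ⟨c1, c2⟩
    · exact ⟨z, (hx _).1, c1, c2, rfl, rfl⟩
    · exact ⟨-z, neg_ne_zero.2 (hx _).1, by simpa using c1, by simpa using c2, hN_neg z,
        by rw [Lf_neg, abs_neg]⟩
  choose y y0 y1 y2 y3 y4 using hsgn
  refine ⟨y, fun k => ⟨y0 k, y1 k, y2 k, ?_, ?_, ?_, ?_, ?_⟩⟩
  · rw [y3]; exact hbig k
  · rw [y3, y3]; exact (hx (k0 + k)).2.1
  · rw [y4, y4]; exact (hx (k0 + k)).2.2.1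
  · rw [y3, y4]; exact (hx (k0 + k)).2.2.2
  · rw [y3, y4]; exact h16 k

lemma main_contra (α β ε X₀ : ℝ) (hε : 0 < ε) (hneg : NegS α β ε X₀)
    (hL : ∀ q : Fin 3 → ℤ, q ≠ 0 → Lf α β q ≠ 0) : False := by
  obtain ⟨B, hB⟩ := threshold ε ((2 * 256 ^ γ / ε) ^ γ) X₀ hε
  set K := (2 * 256 ^ γ / ε) ^ γ with hK
  obtain ⟨y, hy⟩ := normalize_seq α β ε X₀ B hneg
    (fun X hX => ⟨(hB X hX).1, (hB X hX).2.1, (hB X hX).2.2.1⟩) hL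
  have y0 := fun k => (hy k).1
  have y1 := fun k => (hy k).2.1
  have y2 := fun k => (hy k).2.2.1
  have yB := fun k => (hy k).2.2.2.1
  have yX := fun k => (hy k).2.2.2.2.1
  have yL := fun k => (hy k).2.2.2.2.2.1
  have ymin := fun k => (hy k).2.2.2.2.2.2.1
  have y16 := fun k => (hy k).2.2.2.2.2.2.2
  have y3 : ∀ k, (3 : ℝ) ≤ hN (y k) := fun k => (hB _ (yB k)).2.1
  have ypos : ∀ k, (0 : ℝ) < hN (y k) := fun k => by linarith [y3 k]
  have yposZ : ∀ k, 0 < hN (y k) := fun k => by exact_mod_cast ypos k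
  have yXR : ∀ k, (hN (y k) : ℝ) < hN (y (k + 1)) := fun k => by exact_mod_cast yX k
  have ylR : ∀ k, (hN (y k) : ℝ) = (y k 1 : ℝ) - y k 2 := fun k => by
    rw [hN_eq _ (y1 k) (y2 k)]; push_cast; ring
  have ysm : ∀ k, |Lf α β (y k)| ≤ ε * (hN (y (k + 1)) : ℝ) ^ (-γ) := by
    intro k
    refine le_trans ?_ (hB _ (yB (k + 1))).2.2.1
    have := ypos (k + 1)
    rw [le_div_iff₀ (by positivity)]
    exact y16 k
  have yop : ∀ k, Lf α β (y k) * Lf α β (y (k + 1)) < 0 := fun k =>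
    opposite α β ε X₀ hneg (y k) (y (k + 1)) hL (y0 k) (y0 _) (y1 k) (y2 k) (y1 _) (y2 _)
      (yposZ k) (yX k) (yL k) (ymin k) (hB _ (yB (k + 1))).1 (ysm k)
  have yprim := fun k => prim α β (y k) (y (k + 1)) (y0 k) (y1 k) (y2 k) (y1 _) (y2 _)
      (yX k) (yL k) (ymin k)
  have yK : ∀ k, |Lf α β (y k)| * (hN (y (k + 1)) : ℝ) ^ (γ + 1) ≤ K := by
    intro k
    obtain ⟨s, hs⟩ := yprim k
    exact step3 α β ε X₀ hε hneg (y k) (y (k + 1)) s (hN (y k)) (hN (y (k + 1))) (y1 k) (y2 k)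
      (y1 _) (y2 _) (ylR k) (ylR _) (yXR k) (ypos k) (hB _ (yB (k + 1))).1 (yop k) (yL k) (y16 k) hs
  have y4 : ∀ k, |Lf α β (y k)| * (hN (y (k + 1)) : ℝ) ^ 2 ≤ 1 / 4 := fun k =>
    quarter _ _ K (ypos _) (abs_nonneg _) (yK k) (hB _ (yB (k + 1))).2.2.2.1
  -- an independent triple
  obtain ⟨k, hk⟩ : ∃ k, det3Z (y k) (y (k + 1)) (y (k + 2)) ≠ 0 := by
    by_contra hcon
    push Not at hcon
    set F : ℕ → ℝ := fun k => Lf α β (y k) * ((y (k + 1) 1 : ℝ) - y (k + 1) 2)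
      - Lf α β (y (k + 1)) * ((y k 1 : ℝ) - y k 2) with hF
    have hFne : ∀ k, F k ≠ 0 := by
      intro k h
      simp only [hF] at h
      rw [← ylR, ← ylR] at h
      have h1 : Lf α β (y (k + 1)) * (Lf α β (y k) * hN (y (k + 1))
        - Lf α β (y (k + 1)) * hN (y k)) = 0 := by rw [h, mul_zero]
      have h2 := mul_neg_of_neg_of_pos (yop k) (ypos (k + 1))
      have h3 := mul_nonneg (sq_nonneg (Lf α β (y (k + 1)))) (ypos k).le
      nlinarith
    have hFmono : ∀ k, |F k| ≤ |F (k + 1)| := by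
      intro k
      obtain ⟨s, hs⟩ := yprim k
      obtain ⟨c, hc⟩ := par α β (y k) (y (k + 1)) (y (k + 2)) s hs (hcon k)
      have hc' : F (k + 1) = c * F k := hc
      have hc0 : c ≠ 0 := by
        rintro rfl
        apply hFne (k + 1)
        rw [hc']; simp
      have : (1 : ℝ) ≤ |(c : ℝ)| := by exact_mod_cast Int.one_le_abs hc0
      rw [hc', abs_mul]
      nlinarith [abs_nonneg (F k)]
    have hF0 : ∀ k, |F 0| ≤ |F k| := by
      intro k
      induction k with
      | zero => exact le_rfl
      | succ k ih => exact ih.trans (hFmono k)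
    have hFb : ∀ k, |F k| * hN (y (k + 1)) ≤ 1 := by
      intro k
      have h1 : |F k| ≤ |Lf α β (y k)| * hN (y (k + 1)) + |Lf α β (y k)| * hN (y (k + 1)) := by
        simp only [hF]
        rw [← ylR, ← ylR]
        refine (abs_sub _ _).trans ?_
        rw [abs_mul, abs_mul, abs_of_pos (ypos k), abs_of_pos (ypos (k + 1))]
        have := yL k
        have := yXR k
        have := ypos k
        gcongr
      have h2 := mul_le_mul_of_nonneg_right h1 (ypos (k + 1)).le
      have := y4 k
      nlinarith
    have hgrow : ∀ k : ℕ, (k : ℤ) ≤ hN (y k) := by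
      intro k
      induction k with
      | zero => exact hN_nonneg _
      | succ k ih => have := yX k; push_cast; omega
    have hFp : 0 < |F 0| := abs_pos.2 (hFne 0)
    obtain ⟨m, hm⟩ := exists_nat_gt (1 / |F 0|)
    rw [div_lt_iff₀ hFp] at hm
    have h1 : (m : ℝ) ≤ hN (y (m + 1)) := by
      have := (hgrow m).trans (yX m).le
      exact_mod_cast this
    have h2 := hFb m
    have h3 : (m : ℝ) * |F 0| ≤ hN (y (m + 1)) * |F m| := by
      have := hF0 m
      have := ypos (m + 1)
      gcongr
    linarith
  have hD := det_bound α β (y k) (y (k + 1)) (y (k + 2)) (y1 _) (y2 _) (y1 _) (y2 _) (y1 _) (y2 _)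
    (yX k) (yX (k + 1)) (abs_pos.2 (hL _ (y0 k))) (yL (k + 1)) (y4 k) (y4 (k + 1)) hk
  have hfin := step2 α β ε X₀ hneg (y (k + 1)) (y (k + 2)) (hN (y (k + 1))) (hN (y (k + 2))) K
    (y1 _) (y2 _) (y1 _) (y2 _) (ylR _) (ylR _) (yXR (k + 1)) (ypos _) (hB _ (yB (k + 2))).1
    (yL (k + 1)) (yK (k + 1)) hD
  have := (hB _ (yB (k + 1))).2.2.2.2
  linarith

/-- Schmidt's Theorem A. -/
theorem stmt12 (α β : ℝ)
    (hlin : ∀ a b c : ℚ, (a : ℝ) + (b : ℝ) * α + (c : ℝ) * β = 0 → a = 0 ∧ b = 0 ∧ c = 0)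
    (ε : ℝ) (hε : 0 < ε) (X₀ : ℝ) :
    ∃ X : ℝ, X₀ ≤ X ∧ ∃ x : Fin 3 → ℤ,
      |(x 0 : ℝ) + (x 1 : ℝ) * α + (x 2 : ℝ) * β| ≤ ε * X ^ (-γ) ∧
      0 < x 1 ∧ (x 1 : ℝ) ≤ X ∧ 0 < x 2 ∧ (x 2 : ℝ) ≤ X := by
  by_contra hcon
  push Not at hcon
  refine main_contra α β ε X₀ hε ?_ ?_
  · intro X hX z z1 z1X z2 z2X
    by_contra h
    exact absurd (hcon X hX z (not_lt.1 h) z1 z1X z2) (not_lt.2 z2X)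
  · intro q hq h
    apply hq
    obtain ⟨a, b, c⟩ := hlin (q 0) (q 1) (q 2) (by push_cast; exact h)
    ext i
    fin_cases i
    · exact_mod_cast a
    · exact_mod_cast b
    · exact_mod_cast c
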